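/- arXiv:1006.3417 — 2 statements merged into one kernel-verified Lean document; each statement's English description precedes it below -/
import Mathlib

section
/- Let a, b, c, d, e, f, g, h be real numbers with a < c, b > d, e > f, g < h, let τ₁, τ₂ > 0, and let M₁ = [[a, b], [c, d]] and M₂ = [[e, g], [f, h]]. Then there exists a pair (p̄₁, p̄₂) ∈ Δ(2) × Δ(2) such that p̄₁ = σ(M₁ p̄₂ / τ₁) and p̄₂ = σ(M₂ p̄₁ / τ₂), i.e., the static two-player two-action game with entropy regularization admits a Nash equilibrium. -/
/-- Existence of a Nash equilibrium for the entropy-regularized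
static 2×2 security game, with payoff matrices `M₁ = [[a,b],[c,d]]`,
`M₂ = [[e,g],[f,h]]`, under Assumption 1 (`a < c`, `b > d`, `e > f`, `g < h`)
and `τ₁, τ₂ > 0`. -/
theorem nash_equilibrium_exists (a b c d e f g h τ₁ τ₂ : ℝ)
    (hac : a < c) (hbd : b > d) (hef : e > f) (hgh : g < h)
    (hτ₁ : 0 < τ₁) (hτ₂ : 0 < τ₂)
    (σ : ℝ × ℝ → ℝ × ℝ)
    (hσ : ∀ x : ℝ × ℝ,
      σ x = (Real.exp x.1 / (Real.exp x.1 + Real.exp x.2),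
             Real.exp x.2 / (Real.exp x.1 + Real.exp x.2)))
    (M₁ M₂ : ℝ × ℝ → ℝ × ℝ)
    (hM₁ : ∀ p : ℝ × ℝ, M₁ p = (a * p.1 + b * p.2, c * p.1 + d * p.2))
    (hM₂ : ∀ p : ℝ × ℝ, M₂ p = (e * p.1 + g * p.2, f * p.1 + h * p.2)) :
    ∃ p₁ p₂ : ℝ × ℝ,
      (0 ≤ p₁.1 ∧ 0 ≤ p₁.2 ∧ p₁.1 + p₁.2 = 1) ∧
      (0 ≤ p₂.1 ∧ 0 ≤ p₂.2 ∧ p₂.1 + p₂.2 = 1) ∧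
      p₁ = σ ((1 / τ₁) • M₁ p₂) ∧ p₂ = σ ((1 / τ₂) • M₂ p₁) := by
  have hσ_simplex (x : ℝ × ℝ) : 0 ≤ (σ x).1 ∧ 0 ≤ (σ x).2 ∧ (σ x).1 + (σ x).2 = 1 := by
    rw [hσ]
    refine ⟨by positivity, by positivity, ?_⟩
    rw [← add_div, div_self (by positivity)]
  have hσ_cont : Continuous σ := by
    rw [funext hσ]
    refine .prodMk (.div₀ (by fun_prop) (by fun_prop) fun x => ?_)
      (.div₀ (by fun_prop) (by fun_prop) fun x => ?_) <;> positivity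
  have hM₁_cont : Continuous M₁ := by
    rw [funext hM₁]
    fun_prop
  have hM₂_cont : Continuous M₂ := by
    rw [funext hM₂]
    fun_prop
  let β₁ : ℝ × ℝ → ℝ × ℝ := fun p => σ ((1 / τ₁) • M₁ p)
  let β₂ : ℝ × ℝ → ℝ × ℝ := fun p => σ ((1 / τ₂) • M₂ p)
  have hcont : Continuous fun t : ℝ => (β₁ (β₂ (t, 1 - t))).1 := by
    fun_prop
  obtain ⟨t, -, ht⟩ := exists_mem_Icc_isFixedPt_of_mapsTo hcont.continuousOn
    (zero_le_one' ℝ) fun t _ => by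
      obtain ⟨h₁, h₂, h₃⟩ := hσ_simplex ((1 / τ₁) • M₁ (β₂ (t, 1 - t)))
      exact ⟨h₁, by linarith⟩
  have hfix : (t, 1 - t) = β₁ (β₂ (t, 1 - t)) := by
    have hsum := (hσ_simplex ((1 / τ₁) • M₁ (β₂ (t, 1 - t)))).2.2
    have hfst : (β₁ (β₂ (t, 1 - t))).1 = t := ht
    exact Prod.ext hfst.symm (by linarith)
  refine ⟨(t, 1 - t), β₂ (t, 1 - t), ?_, hσ_simplex _, hfix, rfl⟩
  rw [hfix]
  exact hσ_simplex _
end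

section
/- Let a, b, c, d, e, f, g, h be real numbers with a < c, b > d, e > f, g < h, let τ₁, τ₂ > 0, and let M₁ = [[a, b], [c, d]] and M₂ = [[e, g], [f, h]]. If (p̄₁, p̄₂) ∈ Δ(2) × Δ(2) and (p̃₁, p̃₂) ∈ Δ(2) × Δ(2) both satisfy p̄₁ = σ(M₁ p̄₂ / τ₁), p̄₂ = σ(M₂ p̄₁ / τ₂) and p̃₁ = σ(M₁ p̃₂ / τ₁), p̃₂ = σ(M₂ p̃₁ / τ₂), then (p̄₁, p̄₂) = (p̃₁, p̃₂); i.e., the Nash equilibrium of the static game is unique. -/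
theorem exp_div_exp_add_exp_le {x₁ x₂ y₁ y₂ : ℝ} (hxy : x₁ - x₂ ≤ y₁ - y₂) :
    Real.exp x₁ / (Real.exp x₁ + Real.exp x₂) ≤ Real.exp y₁ / (Real.exp y₁ + Real.exp y₂) := by
  rw [div_le_div_iff₀ (by positivity) (by positivity), mul_add, mul_add, ← Real.exp_add,
    ← Real.exp_add, ← Real.exp_add, ← Real.exp_add, add_comm y₁ x₁]
  exact add_le_add le_rfl (Real.exp_le_exp.2 (by linarith))

/-- Uniqueness of the Nash equilibrium for the entropy-regularized
static 2×2 security game under Assumption 1 (`a < c`, `b > d`, `e > f`, `g < h`)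
and `τ₁, τ₂ > 0`. -/
theorem nash_equilibrium_unique (a b c d e f g h τ₁ τ₂ : ℝ)
    (hac : a < c) (hbd : b > d) (hef : e > f) (hgh : g < h)
    (hτ₁ : 0 < τ₁) (hτ₂ : 0 < τ₂)
    (σ : ℝ × ℝ → ℝ × ℝ)
    (hσ : ∀ x : ℝ × ℝ,
      σ x = (Real.exp x.1 / (Real.exp x.1 + Real.exp x.2),
             Real.exp x.2 / (Real.exp x.1 + Real.exp x.2)))
    (M₁ M₂ : ℝ × ℝ → ℝ × ℝ)
    (hM₁ : ∀ p : ℝ × ℝ, M₁ p = (a * p.1 + b * p.2, c * p.1 + d * p.2))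
    (hM₂ : ∀ p : ℝ × ℝ, M₂ p = (e * p.1 + g * p.2, f * p.1 + h * p.2))
    (p₁ p₂ q₁ q₂ : ℝ × ℝ)
    (hp₁ : 0 ≤ p₁.1 ∧ 0 ≤ p₁.2 ∧ p₁.1 + p₁.2 = 1)
    (hp₂ : 0 ≤ p₂.1 ∧ 0 ≤ p₂.2 ∧ p₂.1 + p₂.2 = 1)
    (hq₁ : 0 ≤ q₁.1 ∧ 0 ≤ q₁.2 ∧ q₁.1 + q₁.2 = 1)
    (hq₂ : 0 ≤ q₂.1 ∧ 0 ≤ q₂.2 ∧ q₂.1 + q₂.2 = 1)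
    (hfp₁ : p₁ = σ ((1 / τ₁) • M₁ p₂)) (hfp₂ : p₂ = σ ((1 / τ₂) • M₂ p₁))
    (hfq₁ : q₁ = σ ((1 / τ₁) • M₁ q₂)) (hfq₂ : q₂ = σ ((1 / τ₂) • M₂ q₁)) :
    (p₁, p₂) = (q₁, q₂) := by
  have hσ_mono : ∀ {τ : ℝ}, 0 < τ → ∀ {x y : ℝ × ℝ}, x.1 - x.2 ≤ y.1 - y.2 →
      (σ ((1 / τ) • x)).1 ≤ (σ ((1 / τ) • y)).1 := by
    intro τ hτ x y hxy
    simp only [hσ, Prod.smul_fst, Prod.smul_snd, smul_eq_mul]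
    apply exp_div_exp_add_exp_le
    rw [← mul_sub, ← mul_sub]
    gcongr
  have hβ₁ : ∀ {r s : ℝ × ℝ}, r.1 + r.2 = 1 → s.1 + s.2 = 1 → r.1 ≤ s.1 →
      (σ ((1 / τ₁) • M₁ s)).1 ≤ (σ ((1 / τ₁) • M₁ r)).1 := by
    intro r s hr hs hrs
    apply hσ_mono hτ₁
    simp only [hM₁, eq_sub_of_add_eq' hr, eq_sub_of_add_eq' hs]
    nlinarith
  have hβ₂ : ∀ {r s : ℝ × ℝ}, r.1 + r.2 = 1 → s.1 + s.2 = 1 → r.1 ≤ s.1 →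
      (σ ((1 / τ₂) • M₂ r)).1 ≤ (σ ((1 / τ₂) • M₂ s)).1 := by
    intro r s hr hs hrs
    apply hσ_mono hτ₂
    simp only [hM₂, eq_sub_of_add_eq' hr, eq_sub_of_add_eq' hs]
    nlinarith
  have h_fst : p₁.1 = q₁.1 := by
    rcases le_total p₁.1 q₁.1 with hle | hle
    · have h₂ := hβ₂ hp₁.2.2 hq₁.2.2 hle
      rw [← hfp₂, ← hfq₂] at h₂
      have h₁ := hβ₁ hp₂.2.2 hq₂.2.2 h₂
      rw [← hfp₁, ← hfq₁] at h₁
      exact le_antisymm hle h₁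
    · have h₂ := hβ₂ hq₁.2.2 hp₁.2.2 hle
      rw [← hfp₂, ← hfq₂] at h₂
      have h₁ := hβ₁ hq₂.2.2 hp₂.2.2 h₂
      rw [← hfp₁, ← hfq₁] at h₁
      exact le_antisymm h₁ hle
  have h₁ : p₁ = q₁ := Prod.ext h_fst (by linarith [hp₁.2.2, hq₁.2.2])
  exact Prod.ext h₁ (by rw [hfp₂, hfq₂, h₁])
end
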